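/- arXiv:2210.02256 — 9 statements merged into one kernel-verified Lean document; each statement's English description precedes it below -/
import Mathlib

section
/- Let 𝒳 be a convex subset of a real vector space, let c > 0, and let f : 𝒳 → ℝ belong to the class E(c). Then f has range bounded by c: for all x, x' ∈ 𝒳, |f(x) − f(x')| ≤ c. -/
/-- If a function in the class `E(c)` increases by more than `c` from `x` to `x'`, then repeatedly
taking midpoints with `x'` makes it decrease without bound, along points whose reflections through
the midpoint of `x` and `x'` have values at most `f x'`. -/
lemma exists_reflected_pair_of_gap {E : Type*} [AddCommGroup E] [Module ℝ E]
    {s : Set E} (hs : Convex ℝ s) {f : E → ℝ} {c : ℝ} (hc : 0 < c)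
    (hEc : ∀ x ∈ s, ∀ x' ∈ s,
      f ((2:ℝ)⁻¹ • (x + x')) ≤
        (1/2) * f x + (1/2) * f x' - (1/(2*c)) * (f x - f x')^2)
    {x x' : E} (hx : x ∈ s) (hx' : x' ∈ s) {e : ℝ} (he : 0 < e) (hgap : c + e ≤ f x' - f x)
    (n : ℕ) :
    ∃ y ∈ s, ∃ z ∈ s, y + z = x + x' ∧ f z ≤ f x' ∧ c + e + n * (e / 2) ≤ f x' - f y := by
  have hmid : ∀ u ∈ s, ∀ v ∈ s, (2:ℝ)⁻¹ • (u + v) ∈ s := fun u hu v hv ↦ by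
    rw [smul_add]
    exact hs hu hv (by norm_num) (by norm_num) (by norm_num)
  induction n with
  | zero => exact ⟨x, hx, x', hx', rfl, le_rfl, by simpa using hgap⟩
  | succ n ih =>
    obtain ⟨y, hy, z, hz, hyz, hfz, hfy⟩ := ih
    refine ⟨_, hmid y hy x' hx', _, hmid z hz x hx, ?_, ?_, ?_⟩
    · rw [← smul_add, show y + x' + (z + x) = (y + z) + (x + x') by abel, hyz, ← two_smul ℝ,
        smul_smul]
      norm_num
    · have h := hEc z hz x hx
      have h0 : 0 ≤ (1/(2*c)) * (f z - f x)^2 := by positivity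
      linarith
    · have h := hEc y hy x' hx'
      have hn : 0 ≤ n * (e / 2) := by positivity
      have hd : (f x' - f y) / 2 + e / 2 ≤ (1/(2*c)) * (f y - f x')^2 := by
        rw [one_div_mul_eq_div, le_div_iff₀ (by positivity)]
        nlinarith [mul_nonneg (by linarith : 0 ≤ f x' - f y - c)
          (by linarith : 0 ≤ f x' - f y - c - e)]
      push_cast
      linarith

/-- Lemma 5: any `f ∈ E(c)` on a convex set has range bounded by `c`. -/
theorem stmt_1 {E : Type*} [AddCommGroup E] [Module ℝ E]
    (s : Set E) (hs : Convex ℝ s) (f : E → ℝ) (c : ℝ) (hc : 0 < c)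
    (hEc : ∀ x ∈ s, ∀ x' ∈ s,
      f ((2:ℝ)⁻¹ • (x + x')) ≤
        (1/2) * f x + (1/2) * f x' - (1/(2*c)) * (f x - f x')^2) :
    ∀ x ∈ s, ∀ x' ∈ s, |f x - f x'| ≤ c := by
  have key : ∀ x ∈ s, ∀ x' ∈ s, f x' - f x ≤ c := by
    intro x hx x' hx'
    by_contra! hlt
    have he : 0 < f x' - f x - c := by linarith
    obtain ⟨n, hn⟩ := exists_nat_gt
      ((2 * f x' - 2 * f ((2:ℝ)⁻¹ • (x + x'))) / ((f x' - f x - c) / 2))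
    rw [div_lt_iff₀ (by linarith)] at hn
    obtain ⟨y, hy, z, hz, hyz, hfz, hfy⟩ :=
      exists_reflected_pair_of_gap hs hc hEc hx hx' he (by linarith) n
    have h := hEc y hy z hz
    rw [hyz] at h
    have h0 : 0 ≤ (1/(2*c)) * (f y - f z)^2 := by positivity
    linarith
  intro x hx x' hx'
  exact abs_sub_le_iff.2 ⟨key x' hx' x hx, key x hx x' hx'⟩
end

section
/- Let 𝒳 be a convex subset of a real normed vector space and let f : 𝒳 → ℝ be L-Lipschitz on 𝒳 (|f(x) − f(x')| ≤ L‖x − x'‖ for all x, x' ∈ 𝒳) and ρ-strongly convex on 𝒳 (for all x, x' ∈ 𝒳 and t ∈ [0,1]: f(t·x + (1−t)·x') ≤ t·f(x) + (1−t)·f(x') − (ρ/2)·t·(1−t)·‖x − x'‖²), with L, ρ > 0. Then f belongs to the class E(4L²/ρ). -/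
/-- Lemma 7: an `L`-Lipschitz and `ρ`-strongly convex function on a convex subset
of a real normed space belongs to `E(4L²/ρ)`. -/
theorem stmt_3 {E : Type*} [NormedAddCommGroup E] [NormedSpace ℝ E]
    (s : Set E) (hs : Convex ℝ s) (f : E → ℝ) (L ρ : ℝ) (hL : 0 < L) (hρ : 0 < ρ)
    (hlip : ∀ x ∈ s, ∀ x' ∈ s, |f x - f x'| ≤ L * ‖x - x'‖)
    (hsc : ∀ x ∈ s, ∀ x' ∈ s, ∀ t ∈ Set.Icc (0:ℝ) 1,
      f (t • x + (1 - t) • x') ≤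
        t * f x + (1 - t) * f x' - (ρ/2) * t * (1 - t) * ‖x - x'‖^2) :
    ∀ x ∈ s, ∀ x' ∈ s,
      f ((2:ℝ)⁻¹ • (x + x')) ≤
        (1/2) * f x + (1/2) * f x' - (1/(2*(4*L^2/ρ))) * (f x - f x')^2 := by
  intro x hx x' hx'
  have hmid := hsc x hx x' hx' 2⁻¹ ⟨by norm_num, by norm_num⟩
  have hpt : (2:ℝ)⁻¹ • x + (1 - (2:ℝ)⁻¹) • x' = (2:ℝ)⁻¹ • (x + x') := by
    rw [smul_add]
    norm_num
  rw [hpt] at hmid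
  have hsq : (f x - f x')^2 ≤ L^2 * ‖x - x'‖^2 := by
    rw [← mul_pow, ← sq_abs (f x - f x')]
    exact pow_le_pow_left₀ (abs_nonneg _) (hlip x hx x' hx') 2
  have hgap : (1/(2*(4*L^2/ρ))) * (f x - f x')^2 ≤ ρ/8 * ‖x - x'‖^2 := by
    calc (1/(2*(4*L^2/ρ))) * (f x - f x')^2
        ≤ (1/(2*(4*L^2/ρ))) * (L^2 * ‖x - x'‖^2) := by gcongr
      _ = ρ/8 * ‖x - x'‖^2 := by
        field_simp
        ring
  linarith
end

section
/- Let X be a real-valued random variable on a probability space with E[X²] < ∞, and suppose X ≤ b almost surely for some b > 0. Then for any λ > 0: log(E[exp(λX)]) ≤ λ·E[X] + (φ(λb)/b²)·E[X²], where φ(u) := exp(u) − 1 − u. -/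
theorem Real.hasSum_exp_sub_one_sub (x : ℝ) :
    HasSum (fun n : ℕ => x ^ (n + 2) / (n + 2).factorial) (Real.exp x - 1 - x) := by
  have h : HasSum (fun n : ℕ => x ^ n / n.factorial) (Real.exp x) := by
    rw [Real.exp_eq_exp_ℝ]
    exact NormedSpace.expSeries_div_hasSum_exp x
  have h2 := (hasSum_nat_add_iff' 2).2 h
  simpa [Finset.sum_range_succ, sub_sub] using h2

theorem Real.exp_sub_one_sub_le_sq_div_two_of_nonpos {x : ℝ} (hx : x ≤ 0) :
    Real.exp x - 1 - x ≤ x ^ 2 / 2 := by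
  have h := Real.quadratic_le_exp_of_nonneg (neg_nonneg.2 hx)
  have hmul : Real.exp x * Real.exp (-x) = 1 := by
    rw [← Real.exp_add, add_neg_cancel, Real.exp_zero]
  have hle : Real.exp x * (1 - x + x ^ 2 / 2) ≤ 1 := by
    nlinarith [mul_le_mul_of_nonneg_left h (Real.exp_pos x).le]
  have hpos : 0 < 1 - x + x ^ 2 / 2 := by nlinarith [sq_nonneg x]
  have hq : 1 ≤ (1 + x + x ^ 2 / 2) * (1 - x + x ^ 2 / 2) := by
    nlinarith [sq_nonneg (x ^ 2)]
  linarith [le_of_mul_le_mul_right (hle.trans hq) hpos]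

theorem Real.exp_sub_one_sub_mul_sq_le {u v : ℝ} (huv : u ≤ v) (hv : 0 ≤ v) :
    (Real.exp u - 1 - u) * v ^ 2 ≤ (Real.exp v - 1 - v) * u ^ 2 := by
  rcases le_total u 0 with hu | hu
  · have h1 := Real.exp_sub_one_sub_le_sq_div_two_of_nonpos hu
    have h2 := Real.quadratic_le_exp_of_nonneg hv
    nlinarith [mul_le_mul_of_nonneg_right h1 (sq_nonneg v),
      mul_le_mul_of_nonneg_right h2 (sq_nonneg u)]
  · refine hasSum_le (fun n => ?_) ((Real.hasSum_exp_sub_one_sub u).mul_right _)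
      ((Real.hasSum_exp_sub_one_sub v).mul_right _)
    have h : u ^ n ≤ v ^ n := by gcongr
    calc u ^ (n + 2) / (n + 2).factorial * v ^ 2
        = u ^ n * (u ^ 2 * v ^ 2 / (n + 2).factorial) := by ring
      _ ≤ v ^ n * (u ^ 2 * v ^ 2 / (n + 2).factorial) := by gcongr
      _ = v ^ (n + 2) / (n + 2).factorial * u ^ 2 := by ring

open MeasureTheory in
/-- Lemma 1 (Bennett-type mgf bound): if `X ≤ b` a.s. then for `λ > 0`,
`log E[exp(λX)] ≤ λ E[X] + φ(λb)/b² · E[X²]` with `φ(u) = exp u − 1 − u`. -/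
theorem stmt_4 {Ω : Type*} [MeasurableSpace Ω] (μ : Measure Ω) [IsProbabilityMeasure μ]
    (X : Ω → ℝ) (hX1 : Integrable X μ) (hX2 : Integrable (fun ω => X ω ^ 2) μ)
    (b : ℝ) (hb : 0 < b) (hXb : ∀ᵐ ω ∂μ, X ω ≤ b)
    (l : ℝ) (hl : 0 < l) :
    Real.log (∫ ω, Real.exp (l * X ω) ∂μ) ≤
      l * (∫ ω, X ω ∂μ) +
        ((Real.exp (l * b) - 1 - l * b) / b^2) * ∫ ω, X ω ^ 2 ∂μ := by
  set c := (Real.exp (l * b) - 1 - l * b) / b ^ 2 with hc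
  have hint : Integrable (fun ω => Real.exp (l * X ω)) μ := by
    refine Integrable.of_bound
      (Real.continuous_exp.comp_aestronglyMeasurable (hX1.aestronglyMeasurable.const_mul l))
      (Real.exp (l * b)) ?_
    filter_upwards [hXb] with ω hω
    rw [Real.norm_eq_abs, Real.abs_exp]
    gcongr
  have hlin : Integrable (fun ω => 1 + l * X ω) μ := (integrable_const 1).add (hX1.const_mul l)
  have hle : ∫ ω, Real.exp (l * X ω) ∂μ ≤ ∫ ω, (1 + l * X ω + c * X ω ^ 2) ∂μ := by
    refine integral_mono_ae hint (hlin.add (hX2.const_mul c)) ?_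
    filter_upwards [hXb] with ω hω
    have h := Real.exp_sub_one_sub_mul_sq_le
      (mul_le_mul_of_nonneg_left hω hl.le) (mul_pos hl hb).le
    have h' : Real.exp (l * X ω) - 1 - l * X ω ≤ c * X ω ^ 2 := by
      rw [hc, div_mul_eq_mul_div, le_div_iff₀ (by positivity)]
      refine le_of_mul_le_mul_right ?_ (pow_pos hl 2)
      linarith
    linarith
  rw [integral_add hlin (hX2.const_mul c), integral_add (integrable_const 1) (hX1.const_mul l),
    integral_const_mul, integral_const_mul] at hle
  simp only [integral_const, probReal_univ, one_smul] at hle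
  linarith [Real.log_le_sub_one_of_pos (integral_exp_pos hint)]
end

section
/- Let X be a real-valued random variable on a probability space with E[X²] < ∞, and suppose X ≥ −b almost surely for some b > 0. Then for any λ ∈ (0, 1/b): log(E[exp(−λX)]) ≤ −λ·E[X] + λ²·E[X²]. -/
/-- The quadratic upper bound on the exponential holds on the whole half-line `x ≤ 1`. -/
theorem exp_le_one_add_add_sq {x : ℝ} (hx : x ≤ 1) : Real.exp x ≤ 1 + x + x ^ 2 := by
  rcases le_or_gt (-1) x with h | h
  · linarith [(abs_le.1 (Real.abs_exp_sub_one_sub_id_le (abs_le.2 ⟨h, hx⟩))).2]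
  · have h0 : Real.exp x ≤ 1 := Real.exp_le_one_iff.2 (by linarith)
    nlinarith

open MeasureTheory in
/-- Corollary 1: if `X ≥ −b` a.s. then for `λ ∈ (0, 1/b)`,
`log E[exp(−λX)] ≤ −λ E[X] + λ² E[X²]`. -/
theorem stmt_5 {Ω : Type*} [MeasurableSpace Ω] (μ : Measure Ω) [IsProbabilityMeasure μ]
    (X : Ω → ℝ) (hX1 : Integrable X μ) (hX2 : Integrable (fun ω => X ω ^ 2) μ)
    (b : ℝ) (hb : 0 < b) (hXb : ∀ᵐ ω ∂μ, -b ≤ X ω)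
    (l : ℝ) (hl : l ∈ Set.Ioo 0 (1/b)) :
    Real.log (∫ ω, Real.exp (-l * X ω) ∂μ) ≤
      -l * (∫ ω, X ω ∂μ) + l^2 * ∫ ω, X ω ^ 2 ∂μ := by
  obtain ⟨hl0, hl1⟩ := hl
  have hlb : l * b < 1 := (lt_div_iff₀ hb).1 hl1
  have hbound : ∀ᵐ ω ∂μ, Real.exp (-l * X ω) ≤ 1 + -l * X ω + l ^ 2 * X ω ^ 2 := by
    filter_upwards [hXb] with ω hω
    have := exp_le_one_add_add_sq (x := -l * X ω) (by nlinarith)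
    linarith [show (-l * X ω) ^ 2 = l ^ 2 * X ω ^ 2 by ring]
  have hlin : Integrable (fun ω => 1 + -l * X ω) μ :=
    (integrable_const 1).add (hX1.const_mul (-l))
  have hquad : Integrable (fun ω => 1 + -l * X ω + l ^ 2 * X ω ^ 2) μ :=
    hlin.add (hX2.const_mul (l ^ 2))
  have hexp : Integrable (fun ω => Real.exp (-l * X ω)) μ := by
    refine hquad.mono' (Real.continuous_exp.comp_aestronglyMeasurable
      (hX1.const_mul (-l)).aestronglyMeasurable) ?_
    filter_upwards [hbound] with ω hω
    rwa [Real.norm_eq_abs, Real.abs_exp]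
  have hmono := integral_mono_ae hexp hquad hbound
  rw [integral_add hlin (hX2.const_mul (l ^ 2)),
    integral_add (integrable_const 1) (hX1.const_mul (-l)), integral_const_mul,
    integral_const_mul, integral_const, probReal_univ, one_smul] at hmono
  linarith [Real.log_le_sub_one_of_pos (integral_exp_pos hexp)]
end

section
/- Let (Ω, ℱ, P) be a probability space with a filtration (ℱ_i)_{i ≥ 0}, and let (ξ_i)_{i ≥ 1} be a square-integrable martingale difference sequence adapted to (ℱ_i) (each ξ_i is ℱ_i-measurable with E[ξ_i | ℱ_{i−1}] = 0). Define S_n := Σ_{i=1}^{n} ξ_i and ⟨S⟩_n := Σ_{i=1}^{n} E[ξ_i² | ℱ_{i−1}]. Suppose ξ_i ≤ B almost surely for all i ≥ 1, where B > 0 is a constant. Then for any v > 0 and δ ∈ (0,1): P(∃ k ≥ 1 such that S_k ≥ √(2·v²·log(1/δ)) + 2B·log(1/δ) and ⟨S⟩_k ≤ v²) ≤ δ. -/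
/-- For nonpositive arguments the second order Taylor polynomial dominates the exponential. -/
theorem exp_le_quadratic_of_nonpos {y : ℝ} (hy : y ≤ 0) : Real.exp y ≤ 1 + y + y ^ 2 / 2 := by
  have h := Real.quadratic_le_exp_of_nonneg (x := -y) (by linarith)
  have hmul : Real.exp y * Real.exp (-y) = 1 := by rw [← Real.exp_add]; simp
  have hpos : 0 < 1 + y + y ^ 2 / 2 := by nlinarith [sq_nonneg (y + 1)]
  have h1 : 1 ≤ (1 + y + y ^ 2 / 2) * Real.exp (-y) := by
    have := mul_le_mul_of_nonneg_left h hpos.le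
    nlinarith [sq_nonneg (y ^ 2)]
  have h2 : Real.exp y * 1 ≤ Real.exp y * ((1 + y + y ^ 2 / 2) * Real.exp (-y)) :=
    mul_le_mul_of_nonneg_left h1 (Real.exp_pos y).le
  calc Real.exp y ≤ (1 + y + y ^ 2 / 2) * (Real.exp y * Real.exp (-y)) := by linarith
    _ = 1 + y + y ^ 2 / 2 := by rw [hmul, mul_one]

/-- Bernstein's bound on the exponential of a variable bounded above by `c < 1`. -/
theorem exp_le_one_add_add_sq_div {y c : ℝ} (hc0 : 0 ≤ c) (hc1 : c < 1) (hy : y ≤ c) :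
    Real.exp y ≤ 1 + y + y ^ 2 / (2 * (1 - c)) := by
  have hc : 0 < 1 - c := by linarith
  rcases le_total y 0 with h | h
  · have h1 : y ^ 2 / 2 ≤ y ^ 2 / (2 * (1 - c)) := by
      apply div_le_div_of_nonneg_left (sq_nonneg y) <;> linarith
    linarith [exp_le_quadratic_of_nonpos h]
  · have hb := Real.exp_bound (x := y) (abs_le.2 ⟨by linarith, by linarith⟩) (n := 3) (by norm_num)
    rw [abs_of_nonneg h] at hb
    have hb' := (abs_le.1 hb).2
    norm_num [Finset.sum_range_succ, Nat.factorial] at hb'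
    have h1 : y ^ 2 / 2 + y ^ 3 * (2 / 9) ≤ y ^ 2 / (2 * (1 - c)) := by
      rw [le_div_iff₀ (by linarith)]
      have h2 : 0 ≤ y ^ 2 * (c - y) := mul_nonneg (sq_nonneg y) (by linarith)
      have h3 : 0 ≤ y ^ 3 * c := mul_nonneg (by positivity) hc0
      have h4 : 0 ≤ y ^ 3 := by positivity
      nlinarith
    linarith

section

open MeasureTheory

variable {Ω : Type*} {m0 : MeasurableSpace Ω} {μ : Measure Ω}

/-- Ville's maximal inequality for a nonnegative supermartingale on a finite horizon, together
with the contribution of the paths that never reach the level `ε`. -/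
theorem MeasureTheory.Supermartingale.mul_measureReal_add_setIntegral_le [IsFiniteMeasure μ]
    {ℱ : Filtration ℕ m0} {f : ℕ → Ω → ℝ} (hf : Supermartingale f ℱ μ) (ε : ℝ) (n : ℕ) :
    ε * μ.real {ω | ∃ k ≤ n, ε ≤ f k ω} + ∫ ω in {ω | ∃ k ≤ n, ε ≤ f k ω}ᶜ, f n ω ∂μ
      ≤ ∫ ω, f 0 ω ∂μ := by
  have hlevel : ∀ k, MeasurableSet[ℱ k] {ω | ε ≤ f k ω} := fun k =>
    measurableSet_le measurable_const (hf.stronglyMeasurable k).measurable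
  have hmeas : ∀ n, MeasurableSet[ℱ n] {ω | ∃ k ≤ n, ε ≤ f k ω} := by
    intro n
    have : {ω | ∃ k ≤ n, ε ≤ f k ω} = ⋃ k ∈ Set.Iic n, {ω | ε ≤ f k ω} := by
      ext ω; simp
    rw [this]
    exact MeasurableSet.biUnion (Set.to_countable _) fun k hk => ℱ.mono hk _ (hlevel k)
  have hbound : ∀ (k : ℕ) (s : Set Ω), MeasurableSet s → (∀ ω ∈ s, ε ≤ f k ω) →
      ε * μ.real s ≤ ∫ ω in s, f k ω ∂μ := by
    intro k s hs hle
    have := setIntegral_mono_on (μ := μ) (f := fun _ => ε) (g := f k) (s := s)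
      (integrable_const ε).integrableOn (hf.integrable k).integrableOn hs hle
    simpa [mul_comm] using this
  induction n with
  | zero =>
    have hs : MeasurableSet {ω | ∃ k ≤ 0, ε ≤ f k ω} := ℱ.le 0 _ (hmeas 0)
    rw [← integral_add_compl hs (hf.integrable 0)]
    gcongr
    exact hbound 0 _ hs (by rintro ω ⟨k, hk, h⟩; simpa [Nat.le_zero.1 hk] using h)
  | succ n ih =>
    refine le_trans ?_ ih
    set H := {ω | ∃ k ≤ n, ε ≤ f k ω} with hH
    have hHm : MeasurableSet H := ℱ.le n _ (hmeas n)
    set A := {ω | ε ≤ f (n + 1) ω} with hA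
    have hAm : MeasurableSet A := ℱ.le (n + 1) _ (hlevel (n + 1))
    have hsucc : {ω | ∃ k ≤ n + 1, ε ≤ f k ω} = H ∪ (Hᶜ ∩ A) := by
      ext ω
      simp only [hH, hA, Set.mem_ofPred_eq, Set.mem_union, Set.mem_inter_iff, Set.mem_compl_iff]
      constructor
      · rintro ⟨k, hk, h⟩
        by_cases hω : ∃ k ≤ n, ε ≤ f k ω
        · exact Or.inl hω
        · rcases Nat.le_succ_iff.1 hk with hk | rfl
          · exact (hω ⟨k, hk, h⟩).elim
          · exact Or.inr ⟨hω, h⟩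
      · rintro (⟨k, hk, h⟩ | ⟨-, h⟩)
        · exact ⟨k, by omega, h⟩
        · exact ⟨n + 1, le_rfl, h⟩
    have hcompl : (H ∪ (Hᶜ ∩ A))ᶜ = Hᶜ \ A := by
      ext ω
      simp only [Set.mem_compl_iff, Set.mem_union, Set.mem_inter_iff, Set.mem_sdiff]
      tauto
    rw [hsucc, hcompl, measureReal_union
      (Set.disjoint_left.2 fun ω h h' => h'.1 h) (hHm.compl.inter hAm)]
    have hstep := hf.setIntegral_le (Nat.le_succ n) (hmeas n).compl
    have hsplit := integral_inter_add_sdiff (μ := μ) (s := Hᶜ) hAm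
      (hf.integrable (n + 1)).integrableOn
    have hhit := hbound (n + 1) (Hᶜ ∩ A) (hHm.compl.inter hAm) (fun ω h => h.2)
    simp only [Nat.succ_eq_add_one] at hstep
    rw [mul_add]
    linarith

/-- **Ville's inequality**. -/
theorem MeasureTheory.Supermartingale.measure_exists_le_le [IsFiniteMeasure μ]
    {ℱ : Filtration ℕ m0} {f : ℕ → Ω → ℝ} (hf : Supermartingale f ℱ μ) (hpos : ∀ n ω, 0 ≤ f n ω)
    {ε : ℝ} (hε : 0 < ε) :
    μ {ω | ∃ k, ε ≤ f k ω} ≤ ENNReal.ofReal ((∫ ω, f 0 ω ∂μ) / ε) := by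
  have hU : {ω | ∃ k, ε ≤ f k ω} = ⋃ n : ℕ, {ω | ∃ k ≤ n, ε ≤ f k ω} := by
    ext ω
    simp only [Set.mem_ofPred_eq, Set.mem_iUnion]
    exact ⟨fun ⟨k, h⟩ => ⟨k, k, le_rfl, h⟩, fun ⟨_, k, _, h⟩ => ⟨k, h⟩⟩
  have hmono : Monotone fun n : ℕ => {ω | ∃ k ≤ n, ε ≤ f k ω} :=
    fun a b hab ω ⟨k, hk, h⟩ => ⟨k, hk.trans hab, h⟩
  rw [hU, hmono.measure_iUnion]
  refine iSup_le fun n => ?_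
  rw [← ofReal_measureReal]
  refine ENNReal.ofReal_le_ofReal ?_
  rw [le_div_iff₀ hε, mul_comm]
  have h := hf.mul_measureReal_add_setIntegral_le ε n
  have h0 : 0 ≤ ∫ ω in {ω | ∃ k ≤ n, ε ≤ f k ω}ᶜ, f n ω ∂μ := integral_nonneg (hpos n)
  linarith

/-- The conditional Bernstein bound on the moment generating function of a centred variable
bounded above by `B`. -/
theorem condExp_exp_mul_le [IsProbabilityMeasure μ] {m : MeasurableSpace Ω} (hm : m ≤ m0)
    {X : Ω → ℝ} (hX : Integrable X μ) (hX2 : Integrable (fun ω => X ω ^ 2) μ)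
    (hcent : μ[X | m] =ᵐ[μ] 0) {B l : ℝ} (hB : 0 ≤ B) (hbdd : ∀ᵐ ω ∂μ, X ω ≤ B) (hl : 0 ≤ l)
    (hlB : l * B < 1) :
    μ[fun ω => Real.exp (l * X ω) | m] ≤ᵐ[μ]
      fun ω => Real.exp (l ^ 2 / (2 * (1 - l * B)) * (μ[fun ω' => X ω' ^ 2 | m]) ω) := by
  set g := l ^ 2 / (2 * (1 - l * B)) with hg
  have hle : ∀ᵐ ω ∂μ, Real.exp (l * X ω) ≤ 1 + l * X ω + g * X ω ^ 2 := by
    filter_upwards [hbdd] with ω hω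
    refine (exp_le_one_add_add_sq_div (mul_nonneg hl hB) hlB
      (mul_le_mul_of_nonneg_left hω hl)).trans (le_of_eq ?_)
    rw [hg]
    ring
  have hlin : Integrable ((fun _ => (1 : ℝ)) + l • X) μ := (integrable_const 1).add (hX.smul l)
  have hsq : Integrable (g • fun ω => X ω ^ 2) μ := hX2.smul g
  have hdom : Integrable ((fun _ => (1 : ℝ)) + l • X + g • fun ω => X ω ^ 2) μ := hlin.add hsq
  have hexp : Integrable (fun ω => Real.exp (l * X ω)) μ := by
    refine hdom.mono' (Real.continuous_exp.comp_aestronglyMeasurable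
      (hX.aestronglyMeasurable.const_mul l)) ?_
    filter_upwards [hle] with ω hω
    rw [Real.norm_eq_abs, abs_of_pos (Real.exp_pos _)]
    simpa using hω
  have hmono : μ[fun ω => Real.exp (l * X ω) | m] ≤ᵐ[μ]
      μ[(fun _ => (1 : ℝ)) + l • X + g • fun ω => X ω ^ 2 | m] :=
    condExp_mono hexp hdom (by filter_upwards [hle] with ω hω; simpa using hω)
  filter_upwards [hmono, condExp_add hlin hsq m, condExp_add (integrable_const (1 : ℝ))
    (hX.smul l) m, condExp_smul (μ := μ) l X m, condExp_smul (μ := μ) g (fun ω => X ω ^ 2) m, hcent]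
    with ω h1 h2 h3 h4 h5 h6
  rw [h2, Pi.add_apply, h3, Pi.add_apply, h4, h5, condExp_const hm] at h1
  simp only [Pi.smul_apply, smul_eq_mul, h6, Pi.zero_apply, mul_zero, add_zero] at h1
  refine h1.trans ?_
  linarith [Real.add_one_le_exp (g * (μ[fun ω' => X ω' ^ 2 | m]) ω)]

/-- Freedman's exponential supermartingale. -/
theorem supermartingale_exp_sub [IsProbabilityMeasure μ] {ℱ : Filtration ℕ m0} {ξ : ℕ → Ω → ℝ}
    (hmeas : ∀ i, 1 ≤ i → StronglyMeasurable[ℱ i] (ξ i))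
    (hint : ∀ i, 1 ≤ i → Integrable (ξ i) μ)
    (hsq : ∀ i, 1 ≤ i → Integrable (fun ω => ξ i ω ^ 2) μ)
    (hmds : ∀ i, 1 ≤ i → μ[ξ i | ℱ (i - 1)] =ᵐ[μ] 0)
    {B : ℝ} (hB : 0 ≤ B) (hbdd : ∀ i, 1 ≤ i → ∀ᵐ ω ∂μ, ξ i ω ≤ B)
    {l : ℝ} (hl : 0 ≤ l) (hlB : l * B < 1) :
    Supermartingale (fun n ω => Real.exp (l * ∑ i ∈ Finset.Icc 1 n, ξ i ω -
      l ^ 2 / (2 * (1 - l * B)) *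
        ∑ i ∈ Finset.Icc 1 n, (μ[fun ω' => ξ i ω' ^ 2 | ℱ (i - 1)]) ω)) ℱ μ := by
  have hg0 : 0 ≤ l ^ 2 / (2 * (1 - l * B)) :=
    div_nonneg (sq_nonneg l) (by linarith)
  set g := l ^ 2 / (2 * (1 - l * B)) with hg
  have hS : ∀ n, StronglyMeasurable[ℱ n] fun ω => ∑ i ∈ Finset.Icc 1 n, ξ i ω := fun n =>
    Finset.stronglyMeasurable_fun_sum _ fun i hi =>
      (hmeas i (Finset.mem_Icc.1 hi).1).mono (ℱ.mono (Finset.mem_Icc.1 hi).2)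
  have hV : ∀ n, StronglyMeasurable[ℱ n] fun ω =>
      ∑ i ∈ Finset.Icc 1 (n + 1), (μ[fun ω' => ξ i ω' ^ 2 | ℱ (i - 1)]) ω := fun n =>
    Finset.stronglyMeasurable_fun_sum _ fun i hi =>
      stronglyMeasurable_condExp.mono (ℱ.mono (by have := Finset.mem_Icc.1 hi; omega))
  have hV' : ∀ n, StronglyMeasurable[ℱ n] fun ω =>
      ∑ i ∈ Finset.Icc 1 n, (μ[fun ω' => ξ i ω' ^ 2 | ℱ (i - 1)]) ω := fun n =>
    Finset.stronglyMeasurable_fun_sum _ fun i hi =>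
      stronglyMeasurable_condExp.mono (ℱ.mono (by have := Finset.mem_Icc.1 hi; omega))
  have hadp : ∀ n, StronglyMeasurable[ℱ n] fun ω => Real.exp (l * ∑ i ∈ Finset.Icc 1 n, ξ i ω -
      g * ∑ i ∈ Finset.Icc 1 n, (μ[fun ω' => ξ i ω' ^ 2 | ℱ (i - 1)]) ω) := fun n =>
    Real.continuous_exp.comp_stronglyMeasurable
      (((hS n).const_mul l).sub ((hV' n).const_mul g))
  have hbdd' : ∀ᵐ ω ∂μ, ∀ i, 1 ≤ i → ξ i ω ≤ B :=
    ae_all_iff.2 fun i => by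
      by_cases hi : 1 ≤ i
      · filter_upwards [hbdd i hi] with ω h _ using h
      · exact Filter.Eventually.of_forall fun ω h => (hi h).elim
  have hnonneg : ∀ᵐ ω ∂μ, ∀ i, 0 ≤ (μ[fun ω' => ξ i ω' ^ 2 | ℱ (i - 1)]) ω :=
    ae_all_iff.2 fun i => condExp_nonneg (Filter.Eventually.of_forall fun ω => sq_nonneg _)
  have hintM : ∀ n, Integrable (fun ω => Real.exp (l * ∑ i ∈ Finset.Icc 1 n, ξ i ω -
      g * ∑ i ∈ Finset.Icc 1 n, (μ[fun ω' => ξ i ω' ^ 2 | ℱ (i - 1)]) ω)) μ := by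
    intro n
    refine (integrable_const (Real.exp (l * (n * B)))).mono'
      ((hadp n).mono (ℱ.le n)).aestronglyMeasurable ?_
    filter_upwards [hbdd', hnonneg] with ω h1 h2
    rw [Real.norm_eq_abs, abs_of_pos (Real.exp_pos _), Real.exp_le_exp]
    have hs : ∑ i ∈ Finset.Icc 1 n, ξ i ω ≤ n * B := by
      have := Finset.sum_le_card_nsmul (Finset.Icc 1 n) (fun i => ξ i ω) B
        fun i hi => h1 i (Finset.mem_Icc.1 hi).1
      simpa using this
    have hv : 0 ≤ g * ∑ i ∈ Finset.Icc 1 n, (μ[fun ω' => ξ i ω' ^ 2 | ℱ (i - 1)]) ω :=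
      mul_nonneg hg0 (Finset.sum_nonneg fun i _ => h2 i)
    linarith [mul_le_mul_of_nonneg_left hs hl]
  refine supermartingale_nat hadp hintM fun n => ?_
  have hn : 1 ≤ n + 1 := Nat.le_add_left 1 n
  set W : Ω → ℝ := fun ω => Real.exp (l * ∑ i ∈ Finset.Icc 1 n, ξ i ω -
      g * ∑ i ∈ Finset.Icc 1 (n + 1), (μ[fun ω' => ξ i ω' ^ 2 | ℱ (i - 1)]) ω) with hW
  have hWm : StronglyMeasurable[ℱ n] W := Real.continuous_exp.comp_stronglyMeasurable
    (((hS n).const_mul l).sub ((hV n).const_mul g))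
  have hfac : (fun ω => Real.exp (l * ∑ i ∈ Finset.Icc 1 (n + 1), ξ i ω -
      g * ∑ i ∈ Finset.Icc 1 (n + 1), (μ[fun ω' => ξ i ω' ^ 2 | ℱ (i - 1)]) ω)) =
      W * fun ω => Real.exp (l * ξ (n + 1) ω) := by
    ext ω
    simp only [hW, Pi.mul_apply]
    rw [← Real.exp_add, Finset.sum_Icc_succ_top hn (fun i => ξ i ω)]
    ring_nf
  have hexp : Integrable (fun ω => Real.exp (l * ξ (n + 1) ω)) μ := by
    refine (integrable_const (Real.exp (l * B))).mono' (Real.continuous_exp.comp_aestronglyMeasurable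
      ((hint (n + 1) hn).aestronglyMeasurable.const_mul l)) ?_
    filter_upwards [hbdd (n + 1) hn] with ω hω
    rw [Real.norm_eq_abs, abs_of_pos (Real.exp_pos _), Real.exp_le_exp]
    exact mul_le_mul_of_nonneg_left hω hl
  have hprod := hintM (n + 1)
  rw [hfac] at hprod
  have hmgf := condExp_exp_mul_le (ℱ.le n) (hint (n + 1) hn) (hsq (n + 1) hn)
    (by simpa using hmds (n + 1) hn) hB (hbdd (n + 1) hn) hl hlB
  rw [hfac]
  filter_upwards [condExp_mul_of_stronglyMeasurable_left hWm hprod hexp, hmgf] with ω h1 h2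
  rw [h1, Pi.mul_apply]
  refine (mul_le_mul_of_nonneg_left h2 (Real.exp_pos _).le).trans (le_of_eq ?_)
  rw [← Real.exp_add, ← hg, Finset.sum_Icc_succ_top hn, Nat.add_sub_cancel]
  ring_nf

end

open MeasureTheory Finset in
/-- Freedman's inequality for a martingale difference sequence bounded above by `B`. -/
theorem stmt_10 {Ω : Type*} {m0 : MeasurableSpace Ω} (μ : Measure Ω) [IsProbabilityMeasure μ]
    (ℱ : Filtration ℕ m0) (ξ : ℕ → Ω → ℝ)
    (hmeas : ∀ i, 1 ≤ i → StronglyMeasurable[ℱ i] (ξ i))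
    (hint : ∀ i, 1 ≤ i → Integrable (ξ i) μ)
    (hsq : ∀ i, 1 ≤ i → Integrable (fun ω => ξ i ω ^ 2) μ)
    (hmds : ∀ i, 1 ≤ i → μ[ξ i | ℱ (i - 1)] =ᵐ[μ] 0)
    (B : ℝ) (hB : 0 < B)
    (hbdd : ∀ i, 1 ≤ i → ∀ᵐ ω ∂μ, ξ i ω ≤ B)
    (v δ : ℝ) (hv : 0 < v) (hδ : δ ∈ Set.Ioo (0:ℝ) 1) :
    μ {ω | ∃ k, 1 ≤ k ∧
        Real.sqrt (2 * v^2 * Real.log (1/δ)) + 2 * B * Real.log (1/δ) ≤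
          ∑ i ∈ Finset.Icc 1 k, ξ i ω ∧
        (∑ i ∈ Finset.Icc 1 k, (μ[fun ω' => ξ i ω' ^ 2 | ℱ (i - 1)]) ω) ≤ v^2}
      ≤ ENNReal.ofReal δ := by
  obtain ⟨hδ0, hδ1⟩ := hδ
  have hL : 0 < Real.log (1 / δ) := Real.log_pos (by rw [lt_div_iff₀ hδ0]; linarith)
  have hexpL : Real.exp (Real.log (1 / δ)) = 1 / δ := Real.exp_log (by positivity)
  set L := Real.log (1 / δ)
  set s := Real.sqrt (2 * L) with hs
  have hs2 : s ^ 2 = 2 * L := Real.sq_sqrt (by positivity)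
  have hs0 : 0 < s := Real.sqrt_pos.2 (by positivity)
  have hsqrt : Real.sqrt (2 * v ^ 2 * L) = v * s := by
    rw [show 2 * v ^ 2 * L = v ^ 2 * (2 * L) by ring, Real.sqrt_mul (sq_nonneg v),
      Real.sqrt_sq hv.le]
  have hD : 0 < v + s * B := by positivity
  set l := s / (v + s * B) with hl
  have hl0 : 0 < l := by positivity
  have hlB' : 1 - l * B = v / (v + s * B) := by rw [hl]; field_simp; ring
  have hlB : l * B < 1 := by
    have : 0 < v / (v + s * B) := by positivity
    linarith
  have hg : l ^ 2 / (2 * (1 - l * B)) * v ^ 2 = v * L / (v + s * B) := by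
    rw [hlB', hl]
    field_simp
    linarith
  have hg0 : 0 ≤ l ^ 2 / (2 * (1 - l * B)) := div_nonneg (sq_nonneg l) (by linarith)
  have hM := supermartingale_exp_sub hmeas hint hsq hmds hB.le hbdd hl0.le hlB
  have hville := hM.measure_exists_le_le (fun _ _ => (Real.exp_pos _).le) (Real.exp_pos L)
  refine (measure_mono ?_).trans (hville.trans (le_of_eq ?_))
  · rintro ω ⟨k, -, hk1, hk2⟩
    refine ⟨k, Real.exp_le_exp.2 ?_⟩
    have h1 := mul_le_mul_of_nonneg_left hk1 hl0.le
    have h2 := mul_le_mul_of_nonneg_left hk2 hg0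
    have h3 : L ≤ l * (Real.sqrt (2 * v ^ 2 * L) + 2 * B * L) - v * L / (v + s * B) := by
      rw [hsqrt, hl, div_mul_eq_mul_div, ← sub_div, le_div_iff₀ hD]
      have : 0 < s * B * L := by positivity
      nlinarith
    linarith
  · simp [hexpL]
end

section
/- Let K ≥ 1 and let p : [K] → ℝ be a probability vector with p_i > 0 for all i and Σ_{i=1}^{K} p_i = 1. Consider the two-stage sampling scheme: A is drawn from [K] with law p, B is drawn independently and uniformly at random from [K], ℰ := {A, B} (as a set, possibly a singleton), and I is drawn from ℰ with probability proportional to p restricted to ℰ (i.e., P(I = i | ℰ) = p_i / Σ_{j ∈ ℰ} p_j for i ∈ ℰ). Then the marginal law of I is p: for every i ∈ [K], P(I = i) = p_i; equivalently, Σ_{a=1}^{K} Σ_{b=1}^{K} p_a · (1/K) · [i ∈ {a,b}] · p_i / (Σ_{j ∈ {a,b}} p_j) = p_i. -/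
open Finset in
/-- Lemma (two-stage sampling, marginal law): if `A ~ p`, `B` is uniform on `[K]`
independent of `A`, `ℰ = {A, B}`, and `I` is drawn from `ℰ` with probability
proportional to `p` restricted to `ℰ`, then `P(I = i) = p_i`. -/
theorem stmt_13 (K : ℕ) (hK : 1 ≤ K) (p : ℕ → ℝ)
    (hpos : ∀ i ∈ Finset.Icc 1 K, 0 < p i)
    (hsum : ∑ i ∈ Finset.Icc 1 K, p i = 1)
    (i : ℕ) (hi : i ∈ Finset.Icc 1 K) :
    ∑ a ∈ Finset.Icc 1 K, ∑ b ∈ Finset.Icc 1 K,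
      p a * (1/(K:ℝ)) * ((if i = a ∨ i = b then (1:ℝ) else 0) * p i /
        (∑ j ∈ ({a, b} : Finset ℕ), p j)) = p i := by
  have hK0 : (K : ℝ) ≠ 0 := by positivity
  have hpi := hpos i hi
  have hterm : ∀ a ∈ Finset.Icc 1 K, ∀ b ∈ Finset.Icc 1 K,
      p a * (1/(K:ℝ)) * ((if i = a ∨ i = b then (1:ℝ) else 0) * p i /
        (∑ j ∈ ({a, b} : Finset ℕ), p j)) =
      (if i = a then p i * (1/(K:ℝ)) * (p i / (p i + p b)) else 0) +
        (if i = b then p a * (1/(K:ℝ)) * (p i / (p i + p a)) else 0) := by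
    intro a _ b _
    by_cases ha : i = a
    · subst ha
      by_cases hb : i = b
      · subst hb
        simp only [or_self, if_true, Finset.pair_eq_singleton, Finset.sum_singleton]
        field_simp
      · simp [hb, Finset.sum_pair hb]
    · by_cases hb : i = b
      · subst hb
        simp [ha, Finset.sum_pair (Ne.symm ha), add_comm (p a)]
      · simp [ha, hb]
  have hsplit : ∀ b ∈ Finset.Icc 1 K,
      p i * (1/(K:ℝ)) * (p i / (p i + p b)) + p b * (1/(K:ℝ)) * (p i / (p i + p b)) =
        p i / K := by
    intro b hb
    have hpb := hpos b hb
    field_simp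
  rw [Finset.sum_congr rfl fun a ha => Finset.sum_congr rfl (hterm a ha)]
  simp only [Finset.sum_add_distrib]
  rw [Finset.sum_comm (s := Finset.Icc 1 K)]
  simp only [Finset.sum_ite_eq, hi, if_true]
  rw [← Finset.sum_add_distrib, Finset.sum_congr rfl hsplit, Finset.sum_const, Nat.card_Icc,
    nsmul_eq_mul, Nat.add_sub_cancel]
  field_simp
end

section
/- Let K ≥ 1 and let p : [K] → ℝ be a probability vector with p_i > 0 for all i and Σ_{i=1}^{K} p_i = 1. Consider the two-stage sampling scheme: A is drawn from [K] with law p, B is drawn independently and uniformly at random from [K], ℰ := {A, B} (as a set, possibly a singleton), and I and J are drawn from ℰ independently of each other conditionally on ℰ, each with probability proportional to p restricted to ℰ (i.e., P(I = i | ℰ) = p_i / Σ_{j ∈ ℰ} p_j for i ∈ ℰ, and likewise for J). Then for every i, j ∈ [K]: P(I = i, J = j) ≥ p_i·p_j / K; equivalently, Σ_{a=1}^{K} Σ_{b=1}^{K} p_a · (1/K) · ([i ∈ {a,b}]·p_i / Σ_{u ∈ {a,b}} p_u) · ([j ∈ {a,b}]·p_j / Σ_{u ∈ {a,b}} p_u)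 ≥ p_i·p_j / K. -/
/-- A double sum of nonnegative terms over a square dominates the sum over any subset of it. -/
theorem sum_subset_le_double_sum {s : Finset ℕ} {F : ℕ → ℕ → ℝ}
    (hF : ∀ a ∈ s, ∀ b ∈ s, 0 ≤ F a b) {t : Finset (ℕ × ℕ)} (ht : t ⊆ s ×ˢ s) :
    ∑ x ∈ t, F x.1 x.2 ≤ ∑ a ∈ s, ∑ b ∈ s, F a b := by
  rw [← Finset.sum_product' s s F]
  refine Finset.sum_le_sum_of_subset_of_nonneg ht fun x hx _ => ?_
  rw [Finset.mem_product] at hx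
  exact hF _ hx.1 _ hx.2


open Finset in
/-- Lemma (two-stage sampling, joint law lower bound): with `A ~ p`, `B` uniform on `[K]`
independent of `A`, `ℰ = {A, B}`, and `I, J` drawn from `ℰ` conditionally independently,
each with probability proportional to `p` restricted to `ℰ`, then
`P(I = i, J = j) ≥ p_i p_j / K`. -/
theorem stmt_14 (K : ℕ) (hK : 1 ≤ K) (p : ℕ → ℝ)
    (hpos : ∀ i ∈ Finset.Icc 1 K, 0 < p i)
    (hsum : ∑ i ∈ Finset.Icc 1 K, p i = 1)
    (i j : ℕ) (hi : i ∈ Finset.Icc 1 K) (hj : j ∈ Finset.Icc 1 K) :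
    p i * p j / (K:ℝ) ≤
      ∑ a ∈ Finset.Icc 1 K, ∑ b ∈ Finset.Icc 1 K,
        p a * (1/(K:ℝ)) *
          ((if i = a ∨ i = b then (1:ℝ) else 0) * p i /
            (∑ u ∈ ({a, b} : Finset ℕ), p u)) *
          ((if j = a ∨ j = b then (1:ℝ) else 0) * p j /
            (∑ u ∈ ({a, b} : Finset ℕ), p u)) := by
  have hKpos : (0 : ℝ) < K := by exact_mod_cast hK
  have hpi := hpos i hi
  have hpj := hpos j hj
  have hnonneg : ∀ a ∈ Finset.Icc 1 K, ∀ b ∈ Finset.Icc 1 K, 0 ≤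
      p a * (1/(K:ℝ)) *
        ((if i = a ∨ i = b then (1:ℝ) else 0) * p i /
          (∑ u ∈ ({a, b} : Finset ℕ), p u)) *
        ((if j = a ∨ j = b then (1:ℝ) else 0) * p j /
          (∑ u ∈ ({a, b} : Finset ℕ), p u)) := by
    intro a ha b hb
    have hpa := hpos a ha
    have hab : 0 ≤ ∑ u ∈ ({a, b} : Finset ℕ), p u := by
      refine Finset.sum_nonneg fun u hu => (hpos u ?_).le
      rcases Finset.mem_insert.1 hu with rfl | hu
      · exact ha
      · rwa [Finset.mem_singleton.1 hu]
    have hind (k : ℕ) : (0 : ℝ) ≤ if k = a ∨ k = b then 1 else 0 := by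
      split_ifs <;> norm_num
    have hi' := hind i
    have hj' := hind j
    positivity
  by_cases hij : i = j
  · subst hij
    refine le_trans ?_ (sum_subset_le_double_sum hnonneg (t := {(i, i)}) ?_)
    · have hle : p i ≤ 1 :=
        hsum ▸ Finset.single_le_sum (fun k hk => (hpos k hk).le) hi
      have hsq : p i * p i ≤ p i := by nlinarith
      simp only [Finset.sum_singleton, or_self, if_true, Finset.pair_eq_singleton, one_mul,
        div_self hpi.ne', mul_one, mul_one_div]
      gcongr
    · simpa using hi
  · refine le_trans ?_ (sum_subset_le_double_sum hnonneg (t := {(i, j), (j, i)}) ?_)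
    · have hle : p i + p j ≤ 1 := by
        rw [← hsum, ← Finset.sum_pair hij]
        refine Finset.sum_le_sum_of_subset_of_nonneg ?_ fun k hk _ => (hpos k hk).le
        exact Finset.insert_subset hi (Finset.singleton_subset_iff.2 hj)
      rw [Finset.sum_pair (by simp [hij])]
      simp only [true_or, or_true, if_true, one_mul, Finset.sum_pair hij,
        Finset.sum_pair (Ne.symm hij)]
      have hs : 0 < p i + p j := add_pos hpi hpj
      calc p i * p j / (K : ℝ) ≤ p i * p j / K / (p i + p j) :=
            le_div_self (by positivity) hs hle
        _ = _ := by
            rw [add_comm (p j) (p i)]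
            field_simp
    · refine Finset.insert_subset ?_ (Finset.singleton_subset_iff.2 ?_)
      · exact Finset.mk_mem_product hi hj
      · exact Finset.mk_mem_product hj hi
end

section
/- Let (Ω, ℱ, P) be a probability space, K ≥ 1 an integer, m̃ an integer with 1 ≤ m̃ ≤ K, and ℓ_1, …, ℓ_K real numbers. Fix i ∈ [K]. Let A be a random variable with values in [K] and let χ be a {0,1}-valued random variable independent of A with E[χ] = m̃/K. Define ℓ̂ := (K/m̃)·χ·ℓ_i + (1 − (K/m̃)·χ)·ℓ_A. Then for every integer k ≥ 1: E[(ℓ̂ − ℓ_A)^k] = (K/m̃)^{k−1} · E[(ℓ_i − ℓ_A)^k]. -/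
open MeasureTheory in
/-- Lemma (moments of the loss estimate): with `χ ∈ {0,1}` independent of `A` and
`E[χ] = m̃/K`, the estimate `ℓ̂ = (K/m̃)·χ·ℓ_i + (1 − (K/m̃)·χ)·ℓ_A` satisfies
`E[(ℓ̂ − ℓ_A)^k] = (K/m̃)^{k−1} E[(ℓ_i − ℓ_A)^k]` for every `k ≥ 1`. -/
theorem stmt_15 {Ω : Type*} [MeasurableSpace Ω] (μ : Measure Ω) [IsProbabilityMeasure μ]
    (K mt : ℕ) (hK : 1 ≤ K) (hmt : 1 ≤ mt) (hmtK : mt ≤ K)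
    (ℓ : ℕ → ℝ) (i : ℕ) (hi : i ∈ Finset.Icc 1 K)
    (A : Ω → ℕ) (hA : Measurable A) (hAval : ∀ ω, A ω ∈ Finset.Icc 1 K)
    (χ : Ω → ℝ) (hχ : Measurable χ) (hχval : ∀ ω, χ ω = 0 ∨ χ ω = 1)
    (hindep : ProbabilityTheory.IndepFun χ A μ)
    (hEχ : ∫ ω, χ ω ∂μ = (mt : ℝ) / K) :
    ∀ k : ℕ, 1 ≤ k →
      ∫ ω, (((K:ℝ)/mt) * χ ω * ℓ i + (1 - ((K:ℝ)/mt) * χ ω) * ℓ (A ω) - ℓ (A ω))^k ∂μ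
        = ((K:ℝ)/mt)^(k-1) * ∫ ω, (ℓ i - ℓ (A ω))^k ∂μ := by
  intro k hk
  have hK0 : (K : ℝ) ≠ 0 := by positivity
  have hmt0 : (mt : ℝ) ≠ 0 := by positivity
  have hpow : ∀ ω, χ ω ^ k = χ ω := fun ω => by
    rcases hχval ω with h | h
    · rw [h, zero_pow (by omega)]
    · rw [h, one_pow]
  have hφ : Measurable fun n : ℕ => (ℓ i - ℓ n) ^ k := measurable_from_top
  have hprod : ∫ ω, χ ω * (ℓ i - ℓ (A ω)) ^ k ∂μ
      = (∫ ω, χ ω ∂μ) * ∫ ω, (ℓ i - ℓ (A ω)) ^ k ∂μ :=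
    (hindep.comp measurable_id hφ).integral_fun_mul_eq_mul_integral
      hχ.aestronglyMeasurable (hφ.comp hA).aestronglyMeasurable
  calc
    _ = ∫ ω, ((K : ℝ) / mt) ^ k * (χ ω * (ℓ i - ℓ (A ω)) ^ k) ∂μ := by
      congr 1 with ω
      rw [← hpow ω, ← mul_pow, ← mul_pow, hpow ω]
      ring
    _ = ((K : ℝ) / mt) ^ k * (((mt : ℝ) / K) * ∫ ω, (ℓ i - ℓ (A ω)) ^ k ∂μ) := by
      rw [integral_const_mul, hprod, hEχ]
    _ = _ := by
      obtain ⟨n, rfl⟩ := Nat.exists_eq_add_of_le' hk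
      rw [Nat.add_sub_cancel, pow_succ, ← mul_assoc, mul_assoc (_ ^ n),
        div_mul_div_cancel₀ hmt0, div_self hK0, mul_one]
end

section
/- Let a < b be real numbers, set B := (b − a)² and η := 1/(2B). Then for every y ∈ [a, b], the squared loss x ↦ (x − y)² is η-exp-concave on [a, b]; that is, the function x ↦ exp(−(x − y)²/(2·(b − a)²)) is concave on the interval [a, b]. -/
/-- The Gaussian `x ↦ exp (-c * (x - y) ^ 2)` is concave on any convex set on which
`2 * c * (x - y) ^ 2 ≤ 1`. -/
theorem concaveOn_exp_neg_mul_sub_sq {D : Set ℝ} (hD : Convex ℝ D) {c y : ℝ} (hc : 0 ≤ c)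
    (h : ∀ x ∈ D, 2 * c * (x - y) ^ 2 ≤ 1) :
    ConcaveOn ℝ D (fun x => Real.exp (-c * (x - y) ^ 2)) := by
  have hf (x : ℝ) : HasDerivAt (fun x => Real.exp (-c * (x - y) ^ 2))
      (Real.exp (-c * (x - y) ^ 2) * (-2 * c * (x - y))) x := by
    refine ((((hasDerivAt_id' x).sub_const y).fun_pow 2).const_mul (-c)).exp.congr_deriv ?_
    push_cast
    ring
  have hf' (x : ℝ) : HasDerivAt (fun x => Real.exp (-c * (x - y) ^ 2) * (-2 * c * (x - y)))
      (Real.exp (-c * (x - y) ^ 2) * (2 * c * (2 * c * (x - y) ^ 2 - 1))) x := by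
    refine ((hf x).fun_mul (((hasDerivAt_id' x).sub_const y).const_mul (-2 * c))).congr_deriv ?_
    ring
  have hderiv : deriv (fun x => Real.exp (-c * (x - y) ^ 2)) =
      fun x => Real.exp (-c * (x - y) ^ 2) * (-2 * c * (x - y)) :=
    funext fun x => (hf x).deriv
  refine concaveOn_of_deriv2_nonpos' hD
    (fun x _ => (hf x).differentiableAt.differentiableWithinAt) ?_ fun x hx => ?_
  · rw [hderiv]
    exact fun x _ => (hf' x).differentiableAt.differentiableWithinAt
  · rw [Function.iterate_succ_apply, Function.iterate_one, hderiv, (hf' x).deriv]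
    exact mul_nonpos_of_nonneg_of_nonpos (Real.exp_pos _).le
      (mul_nonpos_of_nonneg_of_nonpos (by positivity) (sub_nonpos.2 (h x hx)))

/-- Remark: the squared loss with bounded outputs is `η`-exp-concave on `[a,b]`
with `η = 1/(2B)`, `B = (b−a)²`: `x ↦ exp(−(x−y)²/(2(b−a)²))` is concave on `[a,b]`. -/
theorem stmt_16 (a b : ℝ) (hab : a < b) (y : ℝ) (hy : y ∈ Set.Icc a b) :
    ConcaveOn ℝ (Set.Icc a b)
      (fun x => Real.exp (-(1/(2*(b-a)^2)) * (x - y)^2)) := by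
  have hpos : 0 < b - a := sub_pos.2 hab
  refine concaveOn_exp_neg_mul_sub_sq (convex_Icc a b) (by positivity) fun x hx => ?_
  have hsq : (x - y) ^ 2 ≤ (b - a) ^ 2 :=
    sq_le_sq' (by linarith [hx.1, hy.2]) (by linarith [hx.2, hy.1])
  calc 2 * (1 / (2 * (b - a) ^ 2)) * (x - y) ^ 2 = (x - y) ^ 2 / (b - a) ^ 2 := by field_simp
    _ ≤ 1 := div_le_one_of_le₀ hsq (sq_nonneg _)
end
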